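/- arXiv:2602.00448 — 4 statements merged into one kernel-verified Lean document; each statement's English description precedes it below -/
import Mathlib

section
/- Let {(x_k, λ_k, θ_k)} be generated by Algorithm ALM-Misspecified VI under Assumption 1, and suppose for each ρ > 0 the map θ ↦ ∇_λ Φ_ρ(x,λ,θ) is L^Φ_{λθ}-Lipschitz uniformly in (x,λ). Define J⁺_k = { j ∈ {1,…,J} : ρ_k f_j(x_{k+1},θ*) + λ_k^{(j)} ≥ 0 } and J⁻_k its complement. Then for any λ ∈ ℝ^J_+ and any k ≥ 0: Σ_{j=1}^J λ^{(j)} f_j(x_{k+1},θ*) − Φ_{ρ_k}(x_{k+1}, λ_k, θ*) ≤ (1/(2ρ_k))(‖λ_k − λ‖² − ‖λ_{k+1} − λ‖²) + L^Φ_{λθ} ‖λ_{k+1} − λ‖ ‖θ_k − θ*‖ + ρ_k L_{f,θ} ‖θ_k − θ*‖ Σ_{j ∈ J⁺_k} |f_j(x_{k+1},θ*)|. -/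
open scoped BigOperators RealInnerProductSpace
open Finset Filter

noncomputable section

/-- Euclidean vectors. -/
abbrev Vec (d : ℕ) := EuclideanSpace ℝ (Fin d)

/-- `p` is the metric projection of `z` onto `S`. -/
def IsProj {d : ℕ} (S : Set (Vec d)) (z p : Vec d) : Prop :=
  p ∈ S ∧ ∀ y ∈ S, ‖z - p‖ ≤ ‖z - y‖

/-- The augmented Lagrangian penalty `φ_ρ(u,v)`. -/
def phi (ρ u v : ℝ) : ℝ :=
  if 0 ≤ ρ * u + v then u * v + ρ / 2 * u ^ 2 else -(v ^ 2) / (2 * ρ)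

/-- `Φ_ρ(x,λ,θ) = ∑_j φ_ρ(f_j(x,θ), λ_j)`. -/
def Phi {n m J : ℕ} (f : Fin J → Vec n → Vec m → ℝ) (ρ : ℝ)
    (x : Vec n) (lam : Vec J) (θ : Vec m) : ℝ :=
  ∑ j, phi ρ (f j x θ) (lam j)

/-- The gradient of `λ ↦ Φ_ρ(x,λ,θ)`. -/
def gradLamPhi {n m J : ℕ} (f : Fin J → Vec n → Vec m → ℝ) (ρ : ℝ)
    (x : Vec n) (lam : Vec J) (θ : Vec m) : Vec J :=
  (WithLp.equiv 2 (Fin J → ℝ)).symm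
    fun j => if 0 ≤ ρ * f j x θ + lam j then f j x θ else -(lam j) / ρ

/-- Assumption 1 of the paper (without Slater's condition, which is stated
separately where needed). -/
structure Assumption1 {n m J : ℕ} (F : Vec n → Vec m → Vec n) (H : Vec m → Vec m)
    (f : Fin J → Vec n → Vec m → ℝ) (X : Set (Vec n)) (Θ : Set (Vec m))
    (LH μH Lfx Lfθ LFx LFθ : ℝ) : Prop where
  Fcont : ∀ θ ∈ Θ, Continuous fun x => F x θ
  Fmono : ∀ θ ∈ Θ, ∀ x ∈ X, ∀ y ∈ X, 0 ≤ ⟪F x θ - F y θ, x - y⟫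
  Hlip : ∀ θ ∈ Θ, ∀ ϑ ∈ Θ, ‖H θ - H ϑ‖ ≤ LH * ‖θ - ϑ‖
  Hsmono : ∀ θ ∈ Θ, ∀ ϑ ∈ Θ, μH * ‖θ - ϑ‖ ^ 2 ≤ ⟪H θ - H ϑ, θ - ϑ⟫
  fconv : ∀ j, ∀ θ ∈ Θ, ConvexOn ℝ X fun x => f j x θ
  flipx : ∀ j, ∀ θ ∈ Θ, ∀ x ∈ X, ∀ y ∈ X, |f j x θ - f j y θ| ≤ Lfx * ‖x - y‖
  flipθ : ∀ j, ∀ x ∈ X, ∀ θ ∈ Θ, ∀ ϑ ∈ Θ, |f j x θ - f j x ϑ| ≤ Lfθ * ‖θ - ϑ‖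
  Flipx : ∀ θ ∈ Θ, ∀ x ∈ X, ∀ y ∈ X, ‖F x θ - F y θ‖ ≤ LFx * ‖x - y‖
  Flipθ : ∀ x ∈ X, ∀ θ ∈ Θ, ∀ ϑ ∈ Θ, ‖F x θ - F x ϑ‖ ≤ LFθ * ‖θ - ϑ‖
  Xne : X.Nonempty
  Xclosed : IsClosed X
  Xconvex : Convex ℝ X
  Θne : Θ.Nonempty
  Θclosed : IsClosed Θ
  Θconvex : Convex ℝ Θ

/-- One run of Algorithm ALM-Misspecified VI, with conventions
`x_{-1} = x_0`, `θ_{-1} = θ_0`, `r_0 = 0`. -/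
structure ALMRun {n m J : ℕ} (F : Vec n → Vec m → Vec n) (H : Vec m → Vec m)
    (f : Fin J → Vec n → Vec m → ℝ) (X : Set (Vec n)) (Θ : Set (Vec m))
    (γ ρ η : ℕ → ℝ) (x : ℕ → Vec n) (lam : ℕ → Vec J) (θ : ℕ → Vec m)
    (r : ℕ → Vec n) : Prop where
  x0mem : x 0 ∈ X
  θ0mem : θ 0 ∈ Θ
  lam0 : lam 0 = 0
  γpos : ∀ k, 0 < γ k
  ρpos : ∀ k, 0 < ρ k
  ηpos : ∀ k, 0 < η k
  r0 : r 0 = 0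
  rstep : ∀ k, r (k + 1) = F (x (k + 1)) (θ (k + 1)) - F (x k) (θ k)
  xstep : ∀ k, IsProj X
    (x k - γ k • (F (x k) (θ k) + r k +
      ∑ j, max (ρ k * f j (x k) (θ k) + lam k j) 0 •
        gradient (fun y => f j y (θ k)) (x k)))
    (x (k + 1))
  lamstep : ∀ k j, lam (k + 1) j = max (lam k j + ρ k * f j (x (k + 1)) (θ k)) 0
  θstep : ∀ k, IsProj Θ (θ k - η k • H (θ k)) (θ (k + 1))

theorem gradLamPhi_apply {n m J : ℕ} (f : Fin J → Vec n → Vec m → ℝ) (ρ : ℝ)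
    (x : Vec n) (lam : Vec J) (θ : Vec m) (j : Fin J) :
    gradLamPhi f ρ x lam θ j =
      if 0 ≤ ρ * f j x θ + lam j then f j x θ else -(lam j) / ρ := rfl

/-- The dual update is a gradient ascent step on `λ ↦ Φ_ρ(x,λ,θ)`. -/
theorem max_eq_add_mul_gradLamPhi {n m J : ℕ} (f : Fin J → Vec n → Vec m → ℝ) {ρ : ℝ}
    (hρ : 0 < ρ) (x : Vec n) (lam : Vec J) (θ : Vec m) (j : Fin J) :
    max (lam j + ρ * f j x θ) 0 = lam j + ρ * gradLamPhi f ρ x lam θ j := by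
  rw [gradLamPhi_apply]
  split_ifs with h
  · exact max_eq_left (by linarith)
  · rw [max_eq_right (by linarith), mul_div_cancel₀ _ hρ.ne']
    ring

theorem mul_sub_phi_le {n m J : ℕ} (f : Fin J → Vec n → Vec m → ℝ) {ρ : ℝ}
    (hρ : 0 < ρ) (x : Vec n) (lam : Vec J) (θ : Vec m) (j : Fin J) {w : ℝ} (hw : 0 ≤ w) :
    w * f j x θ - phi ρ (f j x θ) (lam j) ≤
      gradLamPhi f ρ x lam θ j * (w - lam j) - ρ / 2 * gradLamPhi f ρ x lam θ j ^ 2 := by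
  rw [gradLamPhi_apply, phi]
  split_ifs with h
  · linarith
  · have hf : f j x θ ≤ -(lam j) / ρ := by
      rw [le_div_iff₀ hρ]
      linarith
    have hwf := mul_le_mul_of_nonneg_left hf hw
    have heq : -(lam j) / ρ * (w - lam j) - ρ / 2 * (-(lam j) / ρ) ^ 2 =
        w * (-(lam j) / ρ) - -(lam j ^ 2) / (2 * ρ) := by
      field_simp
      ring
    linarith

theorem sum_mul_sub_Phi_le {n m J : ℕ} (f : Fin J → Vec n → Vec m → ℝ) {ρ : ℝ}
    (hρ : 0 < ρ) (x : Vec n) (lam : Vec J) (θ : Vec m) {w : Vec J} (hw : ∀ j, 0 ≤ w j) :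
    ∑ j, w j * f j x θ - Phi f ρ x lam θ ≤
      ⟪gradLamPhi f ρ x lam θ, w - lam⟫ - ρ / 2 * ‖gradLamPhi f ρ x lam θ‖ ^ 2 := by
  rw [Phi, ← Finset.sum_sub_distrib, EuclideanSpace.real_norm_sq_eq, PiLp.inner_apply,
    Finset.mul_sum, ← Finset.sum_sub_distrib]
  refine Finset.sum_le_sum fun j _ => (mul_sub_phi_le f hρ x lam θ j (hw j)).trans_eq ?_
  simp [mul_comm]

/-- A gradient step from `a` along `g`, compared with the reference direction `g'`. -/
theorem inner_sub_half_sq_le {E : Type*} [NormedAddCommGroup E] [InnerProductSpace ℝ E]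
    {ρ : ℝ} (hρ : 0 < ρ) (a w g g' : E) :
    ⟪g', w - a⟫ - ρ / 2 * ‖g'‖ ^ 2 ≤
      1 / (2 * ρ) * (‖a - w‖ ^ 2 - ‖a + ρ • g - w‖ ^ 2) + ‖g - g'‖ * ‖a + ρ • g - w‖ := by
  have hcs := real_inner_le_norm (g - g') (a + ρ • g - w)
  have hstep : a + ρ • g - w = (a - w) + ρ • g := by abel
  have hneg : w - a = -(a - w) := by abel
  have hsq := norm_sub_sq_real g g'
  have hdist : 1 / (2 * ρ) * (‖a - w‖ ^ 2 - ‖a + ρ • g - w‖ ^ 2) =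
      -⟪g, a - w⟫ - ρ / 2 * ‖g‖ ^ 2 := by
    rw [hstep, norm_add_sq_real, norm_smul, inner_smul_right, real_inner_comm,
      Real.norm_of_nonneg hρ.le]
    field_simp
    ring
  have hinner : ⟪g - g', a + ρ • g - w⟫ =
      ⟪g, a - w⟫ - ⟪g', a - w⟫ + ρ * (‖g‖ ^ 2 - ⟪g, g'⟫) := by
    rw [hstep, inner_add_right, inner_smul_right, inner_sub_left, inner_sub_left,
      real_inner_self_eq_norm_sq, real_inner_comm g g']
  rw [hdist, hneg, inner_neg_right]
  nlinarith [mul_nonneg hρ.le (sq_nonneg ‖g - g'‖)]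

theorem ALMRun.x_mem {n m J : ℕ} {F : Vec n → Vec m → Vec n} {H : Vec m → Vec m}
    {f : Fin J → Vec n → Vec m → ℝ} {X : Set (Vec n)} {Θ : Set (Vec m)}
    {γ ρ η : ℕ → ℝ} {x : ℕ → Vec n} {lam : ℕ → Vec J} {θ : ℕ → Vec m} {r : ℕ → Vec n}
    (run : ALMRun F H f X Θ γ ρ η x lam θ r) : ∀ k, x k ∈ X
  | 0 => run.x0mem
  | k + 1 => (run.xstep k).1

theorem ALMRun.θ_mem {n m J : ℕ} {F : Vec n → Vec m → Vec n} {H : Vec m → Vec m}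
    {f : Fin J → Vec n → Vec m → ℝ} {X : Set (Vec n)} {Θ : Set (Vec m)}
    {γ ρ η : ℕ → ℝ} {x : ℕ → Vec n} {lam : ℕ → Vec J} {θ : ℕ → Vec m} {r : ℕ → Vec n}
    (run : ALMRun F H f X Θ γ ρ η x lam θ r) : ∀ k, θ k ∈ Θ
  | 0 => run.θ0mem
  | k + 1 => (run.θstep k).1

theorem ALMRun.lam_succ {n m J : ℕ} {F : Vec n → Vec m → Vec n} {H : Vec m → Vec m}
    {f : Fin J → Vec n → Vec m → ℝ} {X : Set (Vec n)} {Θ : Set (Vec m)}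
    {γ ρ η : ℕ → ℝ} {x : ℕ → Vec n} {lam : ℕ → Vec J} {θ : ℕ → Vec m} {r : ℕ → Vec n}
    (run : ALMRun F H f X Θ γ ρ η x lam θ r) (k : ℕ) :
    lam (k + 1) = lam k + ρ k • gradLamPhi f (ρ k) (x (k + 1)) (lam k) (θ k) := by
  ext j
  rw [run.lamstep, max_eq_add_mul_gradLamPhi f (run.ρpos k)]
  rfl

/-- Lemma 2: for iterates of ALM-Misspecified VI and any
`λ ∈ ℝ^J_+`,
`∑_j λ_j f_j(x_{k+1},θ*) − Φ_{ρ_k}(x_{k+1},λ_k,θ*)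
  ≤ (1/(2ρ_k))(‖λ_k − λ‖² − ‖λ_{k+1} − λ‖²)
    + L^Φ_{λθ}‖λ_{k+1} − λ‖‖θ_k − θ*‖
    + ρ_k L_{f,θ}‖θ_k − θ*‖ ∑_{j∈J⁺_k}|f_j(x_{k+1},θ*)|`. -/
theorem dual_one_step_bound {n m J : ℕ}
    (F : Vec n → Vec m → Vec n) (H : Vec m → Vec m)
    (f : Fin J → Vec n → Vec m → ℝ) (X : Set (Vec n)) (Θ : Set (Vec m))
    (LH μH Lfx Lfθ LFx LFθ LΦlamθ : ℝ) (θstar : Vec m)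
    (γ ρ η : ℕ → ℝ) (x : ℕ → Vec n) (lam : ℕ → Vec J) (θ : ℕ → Vec m)
    (r : ℕ → Vec n)
    (hA : Assumption1 F H f X Θ LH μH Lfx Lfθ LFx LFθ)
    (run : ALMRun F H f X Θ γ ρ η x lam θ r)
    (hθstar : θstar ∈ Θ)
    (hLΦlamθ : ∀ ρ' > (0 : ℝ), ∀ (x' : Vec n) (lam' : Vec J) (θ1 θ2 : Vec m),
      ‖gradLamPhi f ρ' x' lam' θ1 - gradLamPhi f ρ' x' lam' θ2‖ ≤
        LΦlamθ * ‖θ1 - θ2‖)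
    (lam' : Vec J) (hlam' : ∀ j, 0 ≤ lam' j) (k : ℕ) :
    ∑ j, lam' j * f j (x (k + 1)) θstar - Phi f (ρ k) (x (k + 1)) (lam k) θstar
      ≤ 1 / (2 * ρ k) * (‖lam k - lam'‖ ^ 2 - ‖lam (k + 1) - lam'‖ ^ 2)
        + LΦlamθ * ‖lam (k + 1) - lam'‖ * ‖θ k - θstar‖
        + ρ k * Lfθ * ‖θ k - θstar‖ *
            ∑ j ∈ Finset.univ.filter
                (fun j => 0 ≤ ρ k * f j (x (k + 1)) θstar + lam k j),
              |f j (x (k + 1)) θstar| := by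
  have hρ := run.ρpos k
  have hlower := sum_mul_sub_Phi_le f hρ (x (k + 1)) (lam k) θstar hlam'
  have hstep := inner_sub_half_sq_le hρ (lam k) lam'
    (gradLamPhi f (ρ k) (x (k + 1)) (lam k) (θ k))
    (gradLamPhi f (ρ k) (x (k + 1)) (lam k) θstar)
  rw [← run.lam_succ k] at hstep
  have hlip := mul_le_mul_of_nonneg_right
    (hLΦlamθ (ρ k) hρ (x (k + 1)) (lam k) (θ k) θstar) (norm_nonneg (lam (k + 1) - lam'))
  have hextra : 0 ≤ ρ k * Lfθ * ‖θ k - θstar‖ *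
      ∑ j ∈ Finset.univ.filter (fun j => 0 ≤ ρ k * f j (x (k + 1)) θstar + lam k j),
        |f j (x (k + 1)) θstar| := by
    rw [Finset.mul_sum]
    refine Finset.sum_nonneg fun j _ => mul_nonneg ?_ (abs_nonneg _)
    rw [mul_assoc]
    exact mul_nonneg hρ.le ((abs_nonneg _).trans
      (hA.flipθ j _ (run.x_mem (k + 1)) _ (run.θ_mem k) _ hθstar))
  linarith
end
end

section
/- For every ρ > 0, every v ≥ 0, and every u ∈ ℝ, the penalty function satisfies φ_ρ(u,v) ≤ v[u]_+ + (ρ/2)([u]_+)², where [u]_+ = max{u, 0}. -/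
open scoped BigOperators RealInnerProductSpace
open Finset Filter

noncomputable section

/-- For every `ρ > 0`, `v ≥ 0` and `u : ℝ`,
`φ_ρ(u,v) ≤ v[u]_+ + (ρ/2)([u]_+)²`. -/
theorem phi_le_pos_part_bound (ρ : ℝ) (hρ : 0 < ρ) (v : ℝ) (hv : 0 ≤ v) (u : ℝ) :
    phi ρ u v ≤ v * max u 0 + ρ / 2 * (max u 0) ^ 2 := by
  unfold phi
  split_ifs with h
  · rcases le_total u 0 with hu | hu
    · rw [max_eq_right hu]
      nlinarith [mul_nonneg (neg_nonneg.2 hu) h, mul_nonneg (neg_nonneg.2 hu) hv]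
    · rw [max_eq_left hu, mul_comm u v]
  · have hneg : -(v ^ 2) / (2 * ρ) ≤ 0 :=
      div_nonpos_of_nonpos_of_nonneg (neg_nonpos.2 (sq_nonneg v)) (by positivity)
    exact hneg.trans (by positivity)
end
end

section
/- Let ρ > 0, L ≥ 0, δ ≥ 0, and let f, f̃, λ ∈ ℝ^J satisfy |f̃_j − f_j| ≤ Lδ for all j. Set λ⁺ = [λ + ρ f̃]_+, J⁺ = { j : λ⁺_j = λ_j + ρ f̃_j i.e. λ_j + ρ f̃_j ≥ 0 }, and J⁻ its complement. Then (1/(2ρ))‖λ⁺ − λ‖² ≥ (ρ/2) Σ_{j∈J⁺} f_j² + (1/(2ρ)) Σ_{j∈J⁻} λ_j² − ρ L δ Σ_{j∈J⁺} |f_j|. (In the paper, f̃_j = f_j(x_{k+1}, θ_k), f_j = f_j(x_{k+1}, θ*), L = L_{f,θ}, δ = ‖θ_k − θ*‖.) -/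
open scoped BigOperators RealInnerProductSpace
open Finset Filter

noncomputable section

/-- A perturbation of size at most `ε` lowers a square by at most `2 ε |a|`. -/
theorem sq_sub_two_mul_abs_le_sq {a b ε : ℝ} (h : |b - a| ≤ ε) :
    a ^ 2 - 2 * ε * |a| ≤ b ^ 2 := by
  have hprod : |a * (b - a)| ≤ |a| * ε := by
    rw [abs_mul]
    exact mul_le_mul_of_nonneg_left h (abs_nonneg a)
  nlinarith [neg_abs_le (a * (b - a)), sq_nonneg (b - a)]

/-- lower bound on `(1/(2ρ))‖λ⁺ − λ‖²` for the perturbed dual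
update `λ⁺ = [λ + ρ f̃]_+` when `|f̃_j − f_j| ≤ Lδ` componentwise. -/
theorem dual_update_lower_bound {J : ℕ} (ρ L δ : ℝ) (hρ : 0 < ρ) (hL : 0 ≤ L)
    (hδ : 0 ≤ δ) (fv ft : Fin J → ℝ) (lam lamp : Vec J)
    (hpert : ∀ j, |ft j - fv j| ≤ L * δ)
    (hupd : ∀ j, lamp j = max (lam j + ρ * ft j) 0) :
    ρ / 2 * ∑ j ∈ Finset.univ.filter (fun j => 0 ≤ lam j + ρ * ft j), (fv j) ^ 2
      + 1 / (2 * ρ) *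
          ∑ j ∈ Finset.univ.filter (fun j => ¬ 0 ≤ lam j + ρ * ft j), (lam j) ^ 2
      - ρ * L * δ *
          ∑ j ∈ Finset.univ.filter (fun j => 0 ≤ lam j + ρ * ft j), |fv j|
    ≤ 1 / (2 * ρ) * ‖lamp - lam‖ ^ 2 := by
  have hpos : ∀ j ∈ Finset.univ.filter (fun j => 0 ≤ lam j + ρ * ft j),
      ρ / 2 * fv j ^ 2 - ρ * L * δ * |fv j| ≤ 1 / (2 * ρ) * (lamp j - lam j) ^ 2 := by
    intro j hj
    rw [hupd j, max_eq_left (Finset.mem_filter.mp hj).2]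
    have hsq : 1 / (2 * ρ) * (lam j + ρ * ft j - lam j) ^ 2 = ρ / 2 * ft j ^ 2 := by
      field_simp
      ring
    rw [hsq]
    nlinarith [mul_le_mul_of_nonneg_left (sq_sub_two_mul_abs_le_sq (hpert j)) hρ.le]
  have hneg : ∀ j ∈ Finset.univ.filter (fun j => ¬ 0 ≤ lam j + ρ * ft j),
      1 / (2 * ρ) * lam j ^ 2 = 1 / (2 * ρ) * (lamp j - lam j) ^ 2 := by
    intro j hj
    rw [hupd j, max_eq_right (not_le.mp (Finset.mem_filter.mp hj).2).le]
    ring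
  have hnorm : ‖lamp - lam‖ ^ 2 = ∑ j, (lamp j - lam j) ^ 2 := by
    simp [EuclideanSpace.norm_sq_eq]
  have hsum := Finset.sum_le_sum hpos
  rw [Finset.sum_sub_distrib] at hsum
  rw [hnorm, Finset.mul_sum, Finset.mul_sum, Finset.mul_sum, Finset.mul_sum,
    Finset.sum_congr rfl hneg,
    ← Finset.sum_filter_add_sum_filter_not Finset.univ (fun j => 0 ≤ lam j + ρ * ft j)
      (fun j => 1 / (2 * ρ) * (lamp j - lam j) ^ 2)]
  linarith
end
end

section
/- Let ρ > 0, f, λ ∈ ℝ^J, and λ̄ ∈ ℝ^J with λ̄ ≥ 0 componentwise. Set λ⁺ = [λ + ρf]_+, J⁺ = { j : ρ f_j + λ_j ≥ 0 }, J⁻ its complement, g_j = f_j for j ∈ J⁺ and g_j = −λ_j/ρ for j ∈ J⁻, and Φ = Σ_{j∈J⁺} ( (ρ/2) f_j² + λ_j f_j ) − Σ_{j∈J⁻} λ_j²/(2ρ). Then Σ_{j=1}^J λ̄_j f_j − Φ + (λ⁺ − λ̄)ᵀ g ≤ (ρ/2) Σ_{j∈J⁺} f_j² + (1/(2ρ))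 Σ_{j∈J⁻} λ_j² = (1/(2ρ)) ‖λ⁺ − λ‖². -/
open scoped BigOperators RealInnerProductSpace
open Finset Filter

noncomputable section

/-- for `λ̄ ≥ 0`,
`∑_j λ̄_j f_j − Φ + (λ⁺ − λ̄)ᵀ g ≤ (ρ/2)∑_{J⁺} f_j² + (1/(2ρ))∑_{J⁻} λ_j²
 = (1/(2ρ))‖λ⁺ − λ‖²`. -/
theorem aug_lagrangian_upper_bound {J : ℕ} (ρ : ℝ) (hρ : 0 < ρ)
    (fv : Fin J → ℝ) (lam lamp lambar : Vec J) (g : Fin J → ℝ)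
    (hbar : ∀ j, 0 ≤ lambar j)
    (hupd : ∀ j, lamp j = max (lam j + ρ * fv j) 0)
    (hg : ∀ j, g j = if 0 ≤ ρ * fv j + lam j then fv j else -(lam j) / ρ) :
    (∑ j, lambar j * fv j
      - (∑ j ∈ Finset.univ.filter (fun j => 0 ≤ ρ * fv j + lam j),
            (ρ / 2 * (fv j) ^ 2 + lam j * fv j)
          - ∑ j ∈ Finset.univ.filter (fun j => ¬ 0 ≤ ρ * fv j + lam j),
              (lam j) ^ 2 / (2 * ρ))
      + ∑ j, (lamp j - lambar j) * g j
    ≤ ρ / 2 * ∑ j ∈ Finset.univ.filter (fun j => 0 ≤ ρ * fv j + lam j), (fv j) ^ 2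
      + 1 / (2 * ρ) *
          ∑ j ∈ Finset.univ.filter (fun j => ¬ 0 ≤ ρ * fv j + lam j), (lam j) ^ 2)
    ∧ ρ / 2 * ∑ j ∈ Finset.univ.filter (fun j => 0 ≤ ρ * fv j + lam j), (fv j) ^ 2
        + 1 / (2 * ρ) *
            ∑ j ∈ Finset.univ.filter (fun j => ¬ 0 ≤ ρ * fv j + lam j), (lam j) ^ 2
      = 1 / (2 * ρ) * ‖lamp - lam‖ ^ 2 := by
  simp only [EuclideanSpace.norm_sq_eq, Real.norm_eq_abs, sq_abs, PiLp.sub_apply,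
    Finset.sum_filter, Finset.mul_sum, ← Finset.sum_sub_distrib, ← Finset.sum_add_distrib]
  constructor
  · refine Finset.sum_le_sum fun j _ => ?_
    rw [hupd, hg]
    by_cases h : 0 ≤ ρ * fv j + lam j
    · simp only [h, not_true_eq_false, if_true, if_false]
      rw [max_eq_left (by linarith)]
      exact le_of_eq (by ring)
    · simp only [h, not_false_eq_true, if_true, if_false]
      rw [max_eq_right (by linarith)]
      have hneg : fv j + lam j / ρ ≤ 0 := by
        have : fv j + lam j / ρ = (ρ * fv j + lam j) / ρ := by field_simp
        rw [this]
        exact div_nonpos_of_nonpos_of_nonneg (by linarith) hρ.le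
      have hprod := mul_nonpos_of_nonneg_of_nonpos (hbar j) hneg
      calc _ = lambar j * (fv j + lam j / ρ) + lam j ^ 2 / (2 * ρ) := by ring
        _ ≤ lam j ^ 2 / (2 * ρ) := by linarith
        _ = _ := by ring
  · refine Finset.sum_congr rfl fun j _ => ?_
    rw [hupd]
    by_cases h : 0 ≤ ρ * fv j + lam j
    · simp only [h, not_true_eq_false, if_true, if_false]
      rw [max_eq_left (by linarith)]
      field_simp
      ring
    · simp only [h, not_false_eq_true, if_true, if_false]
      rw [max_eq_right (by linarith)]
      ring
end
end
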